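/- Let f ∈ ℂ[x,t] be nonzero. Then f satisfies the generalized bilinear KdV-type equation 2 f_{xt} f − 2 f_t f_x + 6 (f_{xx})² = 0 if and only if there exist a nonzero g ∈ ℂ[t] and constants c₀, c₁, c₂, c₃ ∈ ℂ such that f has one of the following four forms: (0) f = g; (1) f = g·(x + c₀); (3) f = g·(x³ + c₂ x² + (c₂²/3) x + 36 t + c₀); (4) f = g·(x⁴ + c₃ x³ + c₂ x² + (144 t + c₁) x + 36 c₃ t + (1/4) c₁ c₃ − (1/12) c₂²). In particular, the monic (in x) polynomial solutions — the fundamental solutions — are exactly 1, x + c₀, x³ + c₂ x² + (c₂²/3) x + 36 t + c₀, and x⁴ + c₃ x³ + c₂ x² + (144 t + c₁) x + 36 c₃ t + (1/4) c₁ c₃ − (1/12) c₂². -/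

import Mathlib

open Polynomial

/-- Formal partial derivative with respect to `t` on `ℂ[t][x]`
(outer variable `x`, inner variable `t`). -/
noncomputable def dt (f : Polynomial (Polynomial ℂ)) : Polynomial (Polynomial ℂ) :=
  f.sum fun n a => Polynomial.C (Polynomial.derivative a) * Polynomial.X ^ n

/-- Formal partial derivative with respect to `x` on `ℂ[t][x]`. -/
noncomputable def dx (f : Polynomial (Polynomial ℂ)) : Polynomial (Polynomial ℂ) :=
  Polynomial.derivative f

/-- The operator `T f = 2 f_{xt} f − 2 f_t f_x + 6 (f_{xx})²`; the generalized bilinear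
KdV-type equation is `T f = 0`. -/
noncomputable def Tkdv (f : Polynomial (Polynomial ℂ)) : Polynomial (Polynomial ℂ) :=
  2 * dx (dt f) * f - 2 * dt f * dx f + 6 * (dx (dx f)) ^ 2

/-- The degree-three fundamental solution `x³ + c₂ x² + (c₂²/3) x + 36 t + c₀`. -/
noncomputable def cubicSol (c₀ c₂ : ℂ) : Polynomial (Polynomial ℂ) :=
  Polynomial.X ^ 3 + Polynomial.C (Polynomial.C c₂) * Polynomial.X ^ 2
    + Polynomial.C (Polynomial.C (c₂ ^ 2 / 3)) * Polynomial.X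
    + Polynomial.C (Polynomial.C (36 : ℂ) * Polynomial.X + Polynomial.C c₀)

/-- The degree-four fundamental solution
`x⁴ + c₃ x³ + c₂ x² + (144 t + c₁) x + 36 c₃ t + (1/4) c₁ c₃ − (1/12) c₂²`. -/
noncomputable def quarticSol (c₁ c₂ c₃ : ℂ) : Polynomial (Polynomial ℂ) :=
  Polynomial.X ^ 4 + Polynomial.C (Polynomial.C c₃) * Polynomial.X ^ 3
    + Polynomial.C (Polynomial.C c₂) * Polynomial.X ^ 2
    + Polynomial.C (Polynomial.C (144 : ℂ) * Polynomial.X + Polynomial.C c₁) * Polynomial.X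
    + Polynomial.C (Polynomial.C (36 * c₃) * Polynomial.X
        + Polynomial.C (c₁ * c₃ / 4 - c₂ ^ 2 / 12))

lemma coeff_dt (f : ℂ[X][X]) (n : ℕ) : (dt f).coeff n = derivative (f.coeff n) := by
  simp only [dt, Polynomial.sum, finsetSum_coeff, coeff_C_mul, coeff_X_pow]
  simp +contextual

lemma dt_add (f g : ℂ[X][X]) : dt (f + g) = dt f + dt g := by
  ext1 n; simp [coeff_dt]

lemma dt_C (a : ℂ[X]) : dt (C a) = C (derivative a) := by
  ext1 n; simp only [coeff_dt, coeff_C]; split_ifs <;> simp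

lemma dt_X : dt (X : ℂ[X][X]) = 0 := by
  ext1 n; simp only [coeff_dt, coeff_X]; split_ifs <;> simp

lemma dt_mul (f g : ℂ[X][X]) : dt (f * g) = dt f * g + f * dt g := by
  ext1 n
  simp [coeff_dt, coeff_mul, Finset.sum_add_distrib]

lemma dt_pow_succ (f : ℂ[X][X]) (n : ℕ) :
    dt (f ^ (n + 1)) = ((n : ℂ[X][X]) + 1) * f ^ n * dt f := by
  induction n with
  | zero => simp
  | succ n ih => rw [pow_succ, dt_mul, ih]; push_cast; ring

lemma derivative_dt (f : ℂ[X][X]) : derivative (dt f) = dt (derivative f) := by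
  ext1 n
  have : (n : ℂ[X]) + 1 = ((n + 1 : ℕ) : ℂ[X]) := by push_cast; rfl
  simp only [coeff_dt, coeff_derivative, this, derivative_mul, derivative_natCast]
  ring

lemma degree_dt_le (f : ℂ[X][X]) : (dt f).degree ≤ f.degree := by
  rw [degree_le_iff_coeff_zero]
  intro m hm
  rw [coeff_dt, coeff_eq_zero_of_degree_lt hm, derivative_zero]

/-- A polynomial dividing `dt f - r`, with `r` of smaller `x`-degree, forces `dt f = r`. -/
lemma dt_eq_of_dvd_sub {f r : ℂ[X][X]} (hr : r.degree < f.degree) (h : f ∣ dt f - r) :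
    dt f = r := by
  have hf : f ≠ 0 := by rintro rfl; simp at hr
  obtain ⟨c, hc⟩ := h
  have hc0 : c = 0 := by
    by_contra hc0
    have hle : (f * c).degree ≤ f.degree :=
      hc ▸ (degree_sub_le _ _).trans (max_le (degree_dt_le f) hr.le)
    have hle' := natDegree_le_natDegree hle
    rw [natDegree_mul hf hc0] at hle'
    obtain ⟨a, rfl⟩ : ∃ a, c = C a := ⟨_, eq_C_of_natDegree_eq_zero (by lia)⟩
    have h1 := congrArg (coeff · f.natDegree) hc
    simp only [coeff_sub, coeff_dt, coeff_mul_C, coeff_natDegree,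
      coeff_eq_zero_of_degree_lt (hr.trans_le degree_le_natDegree), sub_zero] at h1
    have h2 := degree_derivative_lt (leadingCoeff_ne_zero.2 hf)
    have ha : a ≠ 0 := by rintro rfl; simp at hc0
    rw [h1] at h2
    exact absurd h2 (not_lt.2 (degree_le_mul_left _ ha))
  rw [hc0, mul_zero] at hc
  exact sub_eq_zero.1 hc

lemma Tkdv_eq (f : ℂ[X][X]) : Tkdv f = 2 * derivative (dt f) * f - 2 * dt f * derivative f
    + 6 * (derivative (derivative f)) ^ 2 := rfl

lemma Tkdv_C_mul (g : ℂ[X]) (f : ℂ[X][X]) : Tkdv (C g * f) = C g ^ 2 * Tkdv f := by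
  simp only [Tkdv_eq, dt_mul, dt_C, derivative_mul, derivative_add, derivative_C,
    zero_mul, zero_add]
  ring

/-- The equation in halved form, followed by its first two `x`-derivatives. -/
lemma Tkdv_consequences {f : ℂ[X][X]} (h : Tkdv f = 0) :
    derivative (dt f) * f - dt f * derivative f + 3 * (derivative (derivative f)) ^ 2 = 0 ∧
    f * derivative^[2] (dt f) - dt f * derivative^[2] f
      + 6 * derivative^[2] f * derivative^[3] f = 0 ∧
    f * derivative^[3] (dt f) + derivative f * derivative^[2] (dt f)
      - derivative (dt f) * derivative^[2] f - dt f * derivative^[3] f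
      + 6 * derivative^[3] f ^ 2 + 6 * derivative^[2] f * derivative^[4] f = 0 := by
  have h0 : derivative (dt f) * f - dt f * derivative f
      + 3 * (derivative (derivative f)) ^ 2 = 0 := by
    have h2 : (2 : ℂ[X][X]) ≠ 0 := two_ne_zero
    refine (mul_eq_zero.1 (?_ : 2 * _ = (0 : ℂ[X][X]))).resolve_left h2
    rw [← h, Tkdv_eq]; ring
  have h1 : f * derivative^[2] (dt f) - dt f * derivative^[2] f
      + 6 * derivative^[2] f * derivative^[3] f = 0 := by
    have := congrArg derivative h0
    simp only [derivative_add, derivative_sub, sq, derivative_mul, derivative_zero,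
      derivative_ofNat] at this
    simp only [Function.iterate_succ, Function.iterate_zero, Function.comp, id]
    linear_combination this
  refine ⟨h0, h1, ?_⟩
  have := congrArg derivative h1
  simp only [Function.iterate_succ, Function.iterate_zero, Function.comp, id, derivative_add,
    derivative_sub, derivative_mul, derivative_zero, derivative_ofNat] at this ⊢
  linear_combination this

lemma not_dvd_derivative_of_natDegree_ne_zero {p : ℂ[X][X]} (hp : p.natDegree ≠ 0) : ¬ p ∣ derivative p := by
  intro h
  have h0 : derivative p ≠ 0 := fun h => hp (derivative_eq_zero.1 h)
  exact absurd (natDegree_le_of_dvd h h0) (not_le.2 (natDegree_derivative_lt hp))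

lemma not_sq_dvd_of_Tkdv_eq_zero {f p : ℂ[X][X]} (hf : f ≠ 0) (h : Tkdv f = 0) (hp : Prime p)
    (hd : p.natDegree ≠ 0) : ¬ p ^ 2 ∣ f := by
  intro hpf
  obtain ⟨m, g, hg, hfm⟩ := WfDvdMonoid.max_power_factor hf hp.irreducible
  have hm : 2 ≤ m := by
    by_contra hm
    refine hg ?_
    rw [hfm] at hpf
    obtain ⟨k, hk⟩ : ∃ k, 2 = m + (k + 1) := ⟨1 - m, by lia⟩
    rw [hk, pow_add, mul_dvd_mul_iff_left (pow_ne_zero _ hp.ne_zero)] at hpf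
    exact (dvd_pow_self p k.succ_ne_zero).trans hpf
  obtain ⟨k, rfl⟩ := Nat.exists_eq_add_of_le' hm
  have h0 := (Tkdv_consequences h).1
  have hx : derivative f = p ^ (k + 1) * ((k + 2) * derivative p * g + p * derivative g) := by
    rw [hfm, derivative_mul, derivative_pow_succ]
    simp only [map_add, map_natCast, map_one]; push_cast; ring
  have ht : dt f = p ^ (k + 1) * ((k + 2) * dt p * g + p * dt g) := by
    rw [hfm, dt_mul, dt_pow_succ]; push_cast; ring
  set u := (k + 2) * derivative p * g + p * derivative g with hu
  set v := (k + 2) * dt p * g + p * dt g with hv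
  have hxx : derivative (derivative f) = p ^ k * ((k + 1) * derivative p * u + p * derivative u) := by
    rw [hx, derivative_mul, derivative_pow_succ]
    simp only [map_add, map_natCast, map_one]; ring
  have hxt : derivative (dt f) = p ^ k * ((k + 1) * derivative p * v + p * derivative v) := by
    rw [ht, derivative_mul, derivative_pow_succ]
    simp only [map_add, map_natCast, map_one]; ring
  rw [hxx, hxt, hx, ht] at h0
  have h1 : 3 * ((k + 1) * derivative p * u + p * derivative u) ^ 2
      + p ^ 2 * (((k + 1) * derivative p * v + p * derivative v) * g - v * u) = 0 := by
    refine (mul_eq_zero.1 (?_ : p ^ (2 * k) * _ = (0 : ℂ[X][X]))).resolve_left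
      (pow_ne_zero _ hp.ne_zero)
    rw [← h0, hfm]; ring
  have hn : ∀ n : ℕ, n ≠ 0 → ¬ p ∣ (n : ℂ[X][X]) := by
    intro n hn hpn
    have := natDegree_le_of_dvd hpn (Nat.cast_ne_zero.2 hn)
    rw [natDegree_natCast] at this
    lia
  have h2 : p ∣ ((3 * (k + 1) ^ 2 * (k + 2) ^ 2 : ℕ) : ℂ[X][X]) * (derivative p ^ 4 * g ^ 2) := by
    set s := (k + 1) * derivative p * derivative g + derivative u with hs
    refine ⟨-(6 * ((k + 1) * derivative p * ((k + 2) * derivative p * g)) * s + 3 * p * s ^ 2)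
      - p * (((k + 1) * derivative p * v + p * derivative v) * g - v * u), ?_⟩
    rw [show ((k : ℂ[X][X]) + 1) * derivative p * u + p * derivative u
      = (k + 1) * derivative p * ((k + 2) * derivative p * g) + p * s by rw [hs, hu]; ring] at h1
    push_cast
    linear_combination h1
  rcases hp.dvd_or_dvd h2 with h3 | h3
  · exact hn _ (by positivity) h3
  rcases hp.dvd_or_dvd h3 with h3 | h3
  · exact not_dvd_derivative_of_natDegree_ne_zero hd (hp.dvd_of_dvd_pow h3)
  · exact hg (hp.dvd_of_dvd_pow h3)

lemma dvd_of_Tkdv_eq_zero {f p : ℂ[X][X]} (hf : f ≠ 0) (h : Tkdv f = 0) (hp : Prime p)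
    (hd : p.natDegree ≠ 0) (hpf : p ∣ f) : p ∣ dt f - 6 * derivative^[3] f := by
  obtain ⟨h0, h1, h2⟩ := Tkdv_consequences h
  have h6 : ¬ p ∣ 6 := by
    intro hp6
    have := natDegree_le_of_dvd hp6 (by norm_num)
    rw [show (6 : ℂ[X][X]) = ((6 : ℕ) : ℂ[X][X]) by norm_num, natDegree_natCast] at this
    lia
  have hxx : p ∣ derivative^[2] f * (dt f - 6 * derivative^[3] f) := by
    rw [show derivative^[2] f * (dt f - 6 * derivative^[3] f) = f * derivative^[2] (dt f) by
      linear_combination -h1]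
    exact hpf.mul_right _
  rcases hp.dvd_or_dvd hxx with hxx | hxx
  swap
  · exact hxx
  obtain ⟨g, rfl⟩ := hpf
  have hg : ¬ p ∣ g := fun hg => not_sq_dvd_of_Tkdv_eq_zero hf h hp hd
    (by rw [sq]; exact mul_dvd_mul_left p hg)
  have hpt : dt p = 0 := by
    refine dt_eq_of_dvd_sub (by rw [degree_zero]; exact bot_lt_iff_ne_bot.2 (by simp [hp.ne_zero])) ?_
    rw [sub_zero]
    have : p ∣ dt p * (derivative p * (g * g)) := by
      obtain ⟨w, hw⟩ := hxx
      simp only [Function.iterate_succ, Function.iterate_zero, Function.comp, id] at hw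
      rw [hw, derivative_mul, dt_mul] at h0
      refine ⟨derivative (dt p * g + p * dt g) * g - dt p * g * derivative g
        - dt g * (derivative p * g + p * derivative g) + 3 * p * w ^ 2, ?_⟩
      linear_combination -h0
    rcases hp.dvd_or_dvd this with h3 | h3
    · exact h3
    rcases hp.dvd_or_dvd h3 with h3 | h3
    · exact absurd h3 (not_dvd_derivative_of_natDegree_ne_zero hd)
    · exact absurd ((hp.dvd_or_dvd h3).elim id id) hg
  have ht : p ∣ dt (p * g) := ⟨dt g, by rw [dt_mul, hpt]; ring⟩
  have hxxt : p ∣ derivative^[2] (dt (p * g)) := by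
    obtain ⟨w, hw⟩ := hxx
    refine ⟨dt w, ?_⟩
    simp only [Function.iterate_succ, Function.iterate_zero, Function.comp, id] at hw ⊢
    rw [derivative_dt, derivative_dt, hw, dt_mul, hpt]; ring
  have hxxx : p ∣ 6 * derivative^[3] (p * g) ^ 2 := by
    obtain ⟨a, ha⟩ := ht
    obtain ⟨b, hb⟩ := hxx
    obtain ⟨c, hc⟩ := hxxt
    refine ⟨-(g * derivative^[3] (dt (p * g)) + derivative (p * g) * c
      - derivative (dt (p * g)) * b - a * derivative^[3] (p * g)
      + 6 * b * derivative^[4] (p * g)), ?_⟩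
    rw [hb, hc] at h2
    linear_combination h2 + derivative^[3] (p * g) * ha
  have := hp.dvd_of_dvd_pow ((hp.dvd_or_dvd hxxx).resolve_left h6)
  exact dvd_sub ht (this.mul_left _)

/-- A primitive solution satisfies the linear equation `f_t = 6 f_xxx`. -/
lemma dt_eq_of_Tkdv_eq_zero {f : ℂ[X][X]} (hf : f.IsPrimitive) (h : Tkdv f = 0) :
    dt f = 6 * derivative^[3] f := by
  have hpos : ∀ p : ℂ[X][X], Prime p → p ∣ f → p.natDegree ≠ 0 := by
    intro p hp hpf h0
    obtain ⟨a, rfl⟩ : ∃ a, p = C a := ⟨_, eq_C_of_natDegree_eq_zero h0⟩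
    exact hp.not_isUnit ((hf a hpf).map C)
  have hsq : Squarefree f := by
    rw [squarefree_iff_no_irreducibles hf.ne_zero]
    intro p hp hpf
    refine not_sq_dvd_of_Tkdv_eq_zero hf.ne_zero h hp.prime
      (hpos p hp.prime ((dvd_mul_right p p).trans hpf)) (by rwa [sq])
  refine dt_eq_of_dvd_sub ?_ ?_
  · have h6 : (6 : ℂ[X][X]).degree ≤ 0 := natDegree_eq_zero_iff_degree_le_zero.1 (natDegree_ofNat 6)
    refine (degree_mul_le _ _).trans_lt ?_
    refine (add_le_add_left h6 _).trans_lt ?_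
    rw [zero_add]
    exact ((degree_derivative_le.trans degree_derivative_le).trans_lt
      (degree_derivative_lt hf.ne_zero))
  · by_cases hz : dt f - 6 * derivative^[3] f = 0
    · rw [hz]; exact dvd_zero f
    refine (hsq.isRadical.dvd_radical hf.ne_zero).trans ?_
    rw [UniqueFactorizationMonoid.radical_dvd_iff_primeFactors_subset hz]
    intro p hp
    rw [UniqueFactorizationMonoid.mem_primeFactors,
      UniqueFactorizationMonoid.mem_normalizedFactors_iff' hf.ne_zero] at hp
    rw [UniqueFactorizationMonoid.mem_primeFactors,
      UniqueFactorizationMonoid.mem_normalizedFactors_iff' hz]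
    exact ⟨hp.1, hp.2.1, dvd_of_Tkdv_eq_zero hf.ne_zero h hp.1.prime
      (hpos p hp.1.prime hp.2.2) hp.2.2⟩

lemma exists_eq_C_mul_isPrimitive {f : ℂ[X][X]} (hf : f ≠ 0) :
    ∃ (c : ℂ[X]) (q : ℂ[X][X]), c ≠ 0 ∧ q.IsPrimitive ∧ f = C c * q := by
  obtain ⟨i⟩ : Nonempty (NormalizedGCDMonoid ℂ[X]) := inferInstance
  refine ⟨f.content, f.primPart, ?_, f.isPrimitive_primPart, f.eq_C_content_mul_primPart⟩
  rwa [Ne, content_eq_zero_iff]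

/-- Every nonzero solution is a `ℂ[t]`-multiple of a monic one satisfying `f_t = 6 f_xxx`. -/
lemma exists_monic_of_Tkdv_eq_zero {f : ℂ[X][X]} (hf : f ≠ 0) (h : Tkdv f = 0) :
    ∃ (g : ℂ[X]) (q : ℂ[X][X]), g ≠ 0 ∧ q.Monic ∧ f = C g * q ∧ Tkdv q = 0 ∧
      dt q = 6 * derivative^[3] q := by
  obtain ⟨c, q, hc, hq, rfl⟩ := exists_eq_C_mul_isPrimitive hf
  have hTq : Tkdv q = 0 := by
    rw [Tkdv_C_mul] at h
    exact (mul_eq_zero.1 h).resolve_left (by simpa using hc)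
  have hdt := dt_eq_of_Tkdv_eq_zero hq hTq
  obtain ⟨a, ha⟩ : ∃ a, q.leadingCoeff = C a := by
    refine ⟨_, eq_C_of_natDegree_eq_zero (derivative_eq_zero.1 ?_)⟩
    have h1 := coeff_dt q q.natDegree
    have h2 : (derivative^[3] q).coeff q.natDegree = 0 := by
      rw [coeff_iterate_derivative, coeff_eq_zero_of_natDegree_lt (by lia), smul_zero]
    rwa [hdt, coeff_ofNat_mul, h2, mul_zero, eq_comm] at h1
  have ha0 : a ≠ 0 := by
    rintro rfl
    exact hq.ne_zero (leadingCoeff_eq_zero.1 (by rw [ha, C_0]))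
  refine ⟨c * C a, C (C a⁻¹) * q, mul_ne_zero hc (by simpa using ha0), ?_, ?_, ?_, ?_⟩
  · rw [Monic, leadingCoeff_mul, leadingCoeff_C, ha, ← C_mul, inv_mul_cancel₀ ha0, C_1]
  · rw [← mul_assoc, ← C_mul, mul_assoc c, ← C_mul, mul_inv_cancel₀ ha0, C_1, mul_one]
  · rw [Tkdv_C_mul, hTq, mul_zero]
  · rw [dt_mul, dt_C, derivative_C, C_0, hdt, iterate_derivative_C_mul]
    ring

/-- For monic solutions of `f_t = 6 f_xxx`, the equation becomes an ordinary differential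
equation in `x`. -/
lemma ode_of_Tkdv_eq_zero {q : ℂ[X][X]} (h : Tkdv q = 0) (hdt : dt q = 6 * derivative^[3] q) :
    2 * (q * derivative^[4] q) - 2 * (derivative q * derivative^[3] q)
      + derivative^[2] q * derivative^[2] q = 0 := by
  refine (mul_eq_zero.1 (?_ : 6 * _ = (0 : ℂ[X][X]))).resolve_left (by norm_num)
  rw [← h, Tkdv_eq, hdt]
  simp only [Function.iterate_succ, Function.iterate_zero, Function.comp, id, derivative_mul,
    derivative_ofNat]
  ring

lemma natDegree_le_four_of_ode {q : ℂ[X][X]} (hq : q.Monic)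
    (h : 2 * (q * derivative^[4] q) - 2 * (derivative q * derivative^[3] q)
      + derivative^[2] q * derivative^[2] q = 0) : q.natDegree ≤ 4 := by
  by_contra! hn
  obtain ⟨k, hk⟩ := Nat.exists_eq_add_of_le' hn
  have hlead : q.coeff (k + 5) = 1 := hk ▸ hq
  have hd : ∀ j, (derivative^[j] q).natDegree ≤ k + 5 - j := fun j =>
    (natDegree_iterate_derivative q j).trans (by rw [hk])
  have hdeg : ∀ i j m n, i + m = k + 5 → j + n = k + 5 →
      (derivative^[i] q * derivative^[j] q).coeff (m + n)
        = (derivative^[i] q).coeff m * (derivative^[j] q).coeff n := fun i j m n hi hj =>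
    coeff_mul_add_eq_of_natDegree_le ((hd i).trans (by lia)) ((hd j).trans (by lia))
  have h1 := congrArg (coeff · (k + 5 + (k + 1))) h
  have e1 := hdeg 0 4 (k + 5) (k + 1) (by lia) (by lia)
  have e2 := hdeg 1 3 (k + 4) (k + 2) (by lia) (by lia)
  have e3 := hdeg 2 2 (k + 3) (k + 3) (by lia) (by lia)
  rw [show k + 4 + (k + 2) = k + 5 + (k + 1) by lia] at e2
  rw [show k + 3 + (k + 3) = k + 5 + (k + 1) by lia] at e3
  simp only [Function.iterate_succ, Function.iterate_zero, Function.comp, id, coeff_add,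
    coeff_sub, coeff_ofNat_mul, coeff_derivative, hlead, coeff_zero] at h1 e1 e2 e3
  rw [e1, e2, e3] at h1
  simp only [add_assoc, Nat.reduceAdd] at h1
  push_cast at h1
  have h2 : (((k + 5) * (k + 4) * (k + 2) * (k + 1) : ℕ) : ℂ[X]) = 0 := by
    push_cast
    linear_combination h1
  have := Nat.cast_eq_zero.1 h2
  simp at this

lemma exists_eq_of_derivative_eq_C {a : ℂ[X]} {b : ℂ} (h : derivative a = C b) :
    ∃ c, a = C b * X + C c := by
  obtain ⟨c, hc⟩ : ∃ c, a - C b * X = C c :=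
    ⟨_, eq_C_of_natDegree_eq_zero (derivative_eq_zero.1 (by simp [h]))⟩
  exact ⟨c, by rw [← hc]; ring⟩

lemma classification_of_monic {q : ℂ[X][X]} (hq : q.Monic) (h : Tkdv q = 0)
    (hdt : dt q = 6 * derivative^[3] q) :
    ∃ c₀ c₁ c₂ c₃ : ℂ, q = 1 ∨ q = X + C (C c₀) ∨ q = cubicSol c₀ c₂ ∨ q = quarticSol c₁ c₂ c₃ := by
  have hode := ode_of_Tkdv_eq_zero h hdt
  have hle := natDegree_le_four_of_ode hq hode
  have hlead : q.coeff q.natDegree = 1 := hq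
  have hzero : ∀ m, q.natDegree < m → q.coeff m = 0 := fun m => coeff_eq_zero_of_natDegree_lt
  have hsum := hq.as_sum
  have hc : ∀ j, derivative (q.coeff j)
      = 6 * (q.coeff (j + 3) * ((j + 2 : ℕ) + 1) * ((j + 1 : ℕ) + 1) * (j + 1)) := by
    intro j
    rw [← coeff_dt, hdt]
    simp only [Function.iterate_succ, Function.iterate_zero, Function.comp, id, coeff_ofNat_mul,
      coeff_derivative]
  have hode0 := congrArg (coeff · 0) hode
  simp only [Function.iterate_succ, Function.iterate_zero, Function.comp, id, coeff_add,
    coeff_sub, coeff_ofNat_mul, coeff_derivative, mul_coeff_zero, coeff_zero] at hode0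
  push_cast at hode0
  norm_num at hode0
  interval_cases hn : q.natDegree
  · exact ⟨0, 0, 0, 0, .inl (hq.natDegree_eq_zero.1 hn)⟩
  · have h0 := hc 0
    norm_num [hzero] at h0
    obtain ⟨c₀, hc₀⟩ := exists_eq_of_derivative_eq_C (b := 0) (by simpa using h0)
    refine ⟨c₀, 0, 0, 0, .inr (.inl ?_)⟩
    rw [hsum]
    simp [hc₀]
  · norm_num [hzero, hlead] at hode0
  · have h0 := hc 0
    have h1 := hc 1
    have h2 := hc 2
    norm_num [hzero, hlead] at h0 h1 h2 hode0
    obtain ⟨c₀, hc₀⟩ := exists_eq_of_derivative_eq_C (b := 36) (by rw [h0, map_ofNat])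
    have e1 := eq_C_of_natDegree_eq_zero h1
    have e2 := eq_C_of_natDegree_eq_zero h2
    set c₁ := (q.coeff 1).coeff 0
    set c₂ := (q.coeff 2).coeff 0
    have hrel : c₁ = c₂ ^ 2 / 3 := by
      have := congrArg (eval 0) hode0
      simp only [e1, e2, eval_add, eval_neg, eval_mul, eval_C, eval_ofNat, eval_zero] at this
      linear_combination -this / 12
    refine ⟨c₀, 0, c₂, 0, .inr (.inr (.inl ?_))⟩
    rw [hsum, cubicSol, ← hrel, ← hc₀, ← e1, ← e2]
    simp only [Finset.sum_range_succ, Finset.sum_range_zero]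
    ring
  · have h0 := hc 0
    have h1 := hc 1
    have h2 := hc 2
    have h3 := hc 3
    norm_num [hzero, hlead] at h0 h1 h2 h3 hode0
    have e2 := eq_C_of_natDegree_eq_zero h2
    have e3 := eq_C_of_natDegree_eq_zero h3
    set c₂ := (q.coeff 2).coeff 0
    set c₃ := (q.coeff 3).coeff 0
    obtain ⟨c₁, hc₁⟩ := exists_eq_of_derivative_eq_C (b := 144) (by rw [h1, map_ofNat])
    obtain ⟨c₀, hc₀⟩ := exists_eq_of_derivative_eq_C (b := 36 * c₃)
      (by rw [h0, e3, C_mul, map_ofNat]; ring)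
    have hrel : c₀ = c₁ * c₃ / 4 - c₂ ^ 2 / 12 := by
      have := congrArg (eval 0) hode0
      simp only [hc₀, hc₁, e2, e3, eval_add, eval_sub, eval_mul, eval_C, eval_X, eval_ofNat,
        eval_zero] at this
      linear_combination this / 48
    refine ⟨0, c₁, c₂, c₃, .inr (.inr (.inr ?_))⟩
    rw [hsum, quarticSol, ← hrel, ← hc₀, ← hc₁, ← e2, ← e3]
    simp only [Finset.sum_range_succ, Finset.sum_range_zero]
    ring

lemma Tkdv_one : Tkdv 1 = 0 := by
  rw [Tkdv_eq, ← C_1, dt_C]; simp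

lemma Tkdv_X_add_C (c : ℂ) : Tkdv (X + C (C c)) = 0 := by
  rw [Tkdv_eq, dt_add, dt_C, dt_X]; simp

lemma Tkdv_cubicSol (c₀ c₂ : ℂ) : Tkdv (cubicSol c₀ c₂) = 0 := by
  have hs : 3 * C (C (c₂ ^ 2 / 3)) = (C (C c₂) : ℂ[X][X]) ^ 2 := by
    rw [← C_pow, ← C_pow, ← map_ofNat (C.comp C : ℂ →+* ℂ[X][X]) 3, RingHom.comp_apply, ← C_mul,
      ← C_mul]
    congr 2; ring
  rw [Tkdv_eq]
  simp only [cubicSol, dt_add, dt_mul, dt_pow_succ, dt_C, dt_X]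
  simp
  simp only [map_ofNat]
  linear_combination (-24) * hs

lemma Tkdv_quarticSol (c₁ c₂ c₃ : ℂ) : Tkdv (quarticSol c₁ c₂ c₃) = 0 := by
  have h1 : 4 * C (C (c₁ * c₃ / 4)) = (C (C c₁) * C (C c₃) : ℂ[X][X]) := by
    rw [← C_mul, ← C_mul, ← map_ofNat (C.comp C : ℂ →+* ℂ[X][X]) 4, RingHom.comp_apply, ← C_mul,
      ← C_mul]
    congr 2; ring
  have h2 : 12 * C (C (c₂ ^ 2 / 12)) = (C (C c₂) : ℂ[X][X]) ^ 2 := by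
    rw [← C_pow, ← C_pow, ← map_ofNat (C.comp C : ℂ →+* ℂ[X][X]) 12, RingHom.comp_apply, ← C_mul,
      ← C_mul]
    congr 2; ring
  rw [Tkdv_eq]
  simp only [quarticSol, dt_add, dt_mul, dt_pow_succ, dt_C, dt_X]
  simp
  simp only [map_ofNat]
  linear_combination 72 * h1 - 24 * h2

/-- Characterization of the nonzero polynomial solutions of the generalized bilinear
KdV-type equation: `T f = 0` iff `f` is a `ℂ[t]`-multiple (by a nonzero `g ∈ ℂ[t]`) of one
of the four fundamental solutions `1`, `x + c₀`,
`x³ + c₂ x² + (c₂²/3) x + 36 t + c₀`, or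
`x⁴ + c₃ x³ + c₂ x² + (144 t + c₁) x + 36 c₃ t + (1/4) c₁ c₃ − (1/12) c₂²`.
In particular, the monic-in-`x` solutions are exactly the fundamental solutions. -/
theorem characterization_of_solutions (f : Polynomial (Polynomial ℂ)) (hf : f ≠ 0) :
    (Tkdv f = 0 ↔
      ∃ (g : Polynomial ℂ) (c₀ c₁ c₂ c₃ : ℂ), g ≠ 0 ∧
        (f = Polynomial.C g ∨
         f = Polynomial.C g * (Polynomial.X + Polynomial.C (Polynomial.C c₀)) ∨
         f = Polynomial.C g * cubicSol c₀ c₂ ∨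
         f = Polynomial.C g * quarticSol c₁ c₂ c₃))
    ∧ (f.Monic →
        (Tkdv f = 0 ↔
          ∃ (c₀ c₁ c₂ c₃ : ℂ),
            f = 1 ∨
            f = Polynomial.X + Polynomial.C (Polynomial.C c₀) ∨
            f = cubicSol c₀ c₂ ∨
            f = quarticSol c₁ c₂ c₃)) := by
  have key : Tkdv f = 0 → ∃ (g : ℂ[X]) (q : ℂ[X][X]), g ≠ 0 ∧ q.Monic ∧ f = C g * q ∧
      ∃ c₀ c₁ c₂ c₃ : ℂ, q = 1 ∨ q = X + C (C c₀) ∨ q = cubicSol c₀ c₂ ∨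
        q = quarticSol c₁ c₂ c₃ := by
    intro h
    obtain ⟨g, q, hg, hq, hfq, hT, hdt⟩ := exists_monic_of_Tkdv_eq_zero hf h
    exact ⟨g, q, hg, hq, hfq, classification_of_monic hq hT hdt⟩
  refine ⟨⟨fun h => ?_, ?_⟩, fun hm => ⟨fun h => ?_, ?_⟩⟩
  · obtain ⟨g, q, hg, -, rfl, c₀, c₁, c₂, c₃, hc⟩ := key h
    refine ⟨g, c₀, c₁, c₂, c₃, hg, ?_⟩
    rcases hc with rfl | rfl | rfl | rfl <;> simp
  · rintro ⟨g, c₀, c₁, c₂, c₃, -, rfl | rfl | rfl | rfl⟩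
    · rw [← mul_one (C g), Tkdv_C_mul, Tkdv_one, mul_zero]
    · rw [Tkdv_C_mul, Tkdv_X_add_C, mul_zero]
    · rw [Tkdv_C_mul, Tkdv_cubicSol, mul_zero]
    · rw [Tkdv_C_mul, Tkdv_quarticSol, mul_zero]
  · obtain ⟨g, q, -, hq, rfl, hc⟩ := key h
    have hg : g = 1 := by
      rwa [Monic, leadingCoeff_mul_monic hq, leadingCoeff_C] at hm
    rwa [hg, C_1, one_mul]
  · rintro ⟨c₀, c₁, c₂, c₃, rfl | rfl | rfl | rfl⟩
    exacts [Tkdv_one, Tkdv_X_add_C c₀, Tkdv_cubicSol c₀ c₂, Tkdv_quarticSol c₁ c₂ c₃]
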